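/- For the wiretap channel of type II with erasing and flipping adversary WCEF-II(p_r, p_e, p_w), every secrecy rate R with R < 1 − p_r + p_e·H(p_w/(1−p_e)) − p_e − H(p_w/(1−p_e)) is securely achievable, where H is the binary entropy function. -/

import Mathlib

/-!
For the wiretap channel of type II with erasing and flipping adversary
WCEF-II(p_r, p_e, p_w), every secrecy rate R with
R < 1 − p_r + p_e·H(p_w/(1−p_e)) − p_e − H(p_w/(1−p_e)) is securely achievable.
-/

open scoped BigOperators

/-- Binary entropy function (in bits). -/
noncomputable def binH (t : ℝ) : ℝ := -t * Real.logb 2 t - (1 - t) * Real.logb 2 (1 - t)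

/-- Number of erasures (`⊥` symbols, encoded as `none`) in a state vector. -/
def numErase {n : ℕ} (s : Fin n → Option Bool) : ℕ :=
  (Finset.univ.filter fun t => s t = none).card

/-- Number of flips (`1` symbols, encoded as `some true`) in a state vector. -/
def numFlip {n : ℕ} (s : Fin n → Option Bool) : ℕ :=
  (Finset.univ.filter fun t => s t = some true).card

/-- Bob's received word: `Y_t = ⊥` if `s_t = ⊥` and `Y_t = X_t ⊕ s_t` otherwise. -/
def cefOut {n : ℕ} (x : Fin n → Bool) (s : Fin n → Option Bool) : Fin n → Option Bool :=
  fun t => (s t).map fun b => xor (x t) b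

/-- James's view when he reads the coordinates in `T`: the transmitted bit on the
coordinates of `T` and a blank symbol (`none`) elsewhere. -/
def view {n : ℕ} (T : Finset (Fin n)) (x : Fin n → Bool) : Fin n → Option Bool :=
  fun t => if t ∈ T then some (x t) else none

/-- A (possibly randomized) jamming function: to each view it assigns a probability
distribution over state vectors with at most `p_e·n` erasures and at most `p_w·n` flips. -/
structure JamFn (pe pw : ℝ) (n : ℕ) where
  J : (Fin n → Option Bool) → (Fin n → Option Bool) → ℝ
  nonneg : ∀ v s, 0 ≤ J v s
  sum_one : ∀ v, ∑ s, J v s = 1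
  supp : ∀ v s, J v s ≠ 0 → (numErase s : ℝ) ≤ pe * n ∧ (numFlip s : ℝ) ≤ pw * n

/-- A (possibly stochastic) encoder: to each message it assigns a probability distribution
over codewords in `{0,1}^n`. -/
structure StochEnc (n K : ℕ) where
  E : Fin K → (Fin n → Bool) → ℝ
  nonneg : ∀ u x, 0 ≤ E u x
  sum_one : ∀ u, ∑ x, E u x = 1

/-- Mutual information (in bits) of a joint probability mass function `P` on `α × β`. -/
noncomputable def miBits {α β : Type*} [Fintype α] [Fintype β] (P : α → β → ℝ) : ℝ :=
  ∑ a, ∑ b, P a b * Real.logb 2 (P a b / ((∑ b', P a b') * (∑ a', P a' b)))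

/-- Joint distribution of the uniform message `U` and James's view `Z^n` when he reads
the coordinates in `T`. -/
noncomputable def jointUZW {n K : ℕ} (E : StochEnc n K) (T : Finset (Fin n)) :
    Fin K → (Fin n → Option Bool) → ℝ :=
  fun u z => (1 / (K : ℝ)) * ∑ x, E.E u x * (if view T x = z then 1 else 0)

/-- Average error probability of a code against James reading the coordinates in `T`
and jamming according to `JF`. -/
noncomputable def avgErrW {n K : ℕ} (E : StochEnc n K)
    (Dec : (Fin n → Option Bool) → Fin K) (T : Finset (Fin n))
    (JF : (Fin n → Option Bool) → (Fin n → Option Bool) → ℝ) : ℝ :=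
  (1 / (K : ℝ)) * ∑ u, ∑ x, E.E u x * ∑ s,
    JF (view T x) s * (if Dec (cefOut x s) = u then 0 else 1)

/-- `R` is a securely achievable rate for `WCEF-II(p_r, p_e, p_w)`: for every `ε > 0`
there is a code such that, for every read set `T` of at most `p_r·n` coordinates and every
jamming function, the average error is at most `ε`, and `(1/n)·I(Z^n;U) ≤ ε`. -/
def SecurelyAchievableW (pr pe pw R : ℝ) : Prop :=
  ∀ ε > (0 : ℝ), ∃ (n K : ℕ) (E : StochEnc n K)
    (Dec : (Fin n → Option Bool) → Fin K),
    0 < n ∧ 0 < K ∧ (2 : ℝ) ^ (R * n) ≤ (K : ℝ) ∧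
    ∀ T : Finset (Fin n), (T.card : ℝ) ≤ pr * n →
      (∀ JF : JamFn pe pw n, avgErrW E Dec T JF.J ≤ ε) ∧
      (1 / (n : ℝ)) * miBits (jointUZW E T) ≤ ε


open Finset in
/-- Union bound for the number of values of a random function that hit a fixed set. -/
theorem card_many_hits_mul_factorial_le {I A : Type*} [Fintype I] [DecidableEq I] [Fintype A]
    [DecidableEq A] (I' : Finset I) (S : Finset A) (k : ℕ) (h : #I' * #S ≤ Fintype.card A)
    (X : Finset (I → A)) (hX : ∀ f ∈ X, k ≤ #{i ∈ I' | f i ∈ S}) :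
    #X * k.factorial ≤ Fintype.card (I → A) := by
  have hsub : X ⊆
      (powersetCard k I').biUnion fun t => Fintype.piFinset fun i => if i ∈ t then S else univ := by
    intro f hf
    obtain ⟨t, ht, htc⟩ := exists_subset_card_eq (hX f hf)
    simp only [mem_biUnion, mem_powersetCard, Fintype.mem_piFinset]
    refine ⟨t, ⟨ht.trans (filter_subset _ _), htc⟩, fun i => ?_⟩
    split_ifs with hi
    · exact (mem_filter.1 (ht hi)).2
    · exact mem_univ _
  have hcard : ∀ t ∈ powersetCard k I',
      #(Fintype.piFinset fun i => if i ∈ t then S else (univ : Finset A)) =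
        #S ^ k * Fintype.card A ^ (Fintype.card I - k) := by
    intro t ht
    obtain ⟨-, htc⟩ := mem_powersetCard.1 ht
    rw [Fintype.card_piFinset]
    simp only [apply_ite Finset.card, prod_ite, prod_const, card_univ]
    rw [filter_mem_eq_inter, univ_inter, htc, ← compl_filter, filter_mem_eq_inter, univ_inter,
      card_compl, htc]
  rcases lt_or_ge (#I') k with hk | hk
  · rw [powersetCard_eq_empty.2 hk] at hsub
    simp [subset_empty.1 hsub]
  have hkI : k ≤ Fintype.card I := hk.trans (card_le_univ _)
  calc _ ≤ (#I').choose k * (#S ^ k * Fintype.card A ^ (Fintype.card I - k)) * k.factorial := by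
        gcongr
        refine (card_le_card hsub).trans (card_biUnion_le.trans ?_)
        rw [sum_congr rfl hcard, sum_const, card_powersetCard, smul_eq_mul]
    _ = (#I').descFactorial k * #S ^ k * Fintype.card A ^ (Fintype.card I - k) := by
        rw [Nat.descFactorial_eq_factorial_mul_choose]; ring
    _ ≤ (#I') ^ k * #S ^ k * Fintype.card A ^ (Fintype.card I - k) := by
        gcongr; exact Nat.descFactorial_le_pow _ _
    _ = (#I' * #S) ^ k * Fintype.card A ^ (Fintype.card I - k) := by rw [mul_pow]
    _ ≤ Fintype.card A ^ k * Fintype.card A ^ (Fintype.card I - k) := by gcongr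
    _ = Fintype.card (I → A) := by
        rw [← pow_add, Nat.add_sub_cancel' hkI, Fintype.card_fun]

open Finset in
/-- A random function composed with an injection is uniformly distributed. -/
theorem card_comp_mem_mul_le {I J A : Type*} [Fintype I] [DecidableEq I] [Fintype J]
    [DecidableEq J] [Fintype A] [DecidableEq A] (e : J → I) (he : Function.Injective e)
    (P : Finset (J → A)) :
    #{f : I → A | f ∘ e ∈ P} * Fintype.card A ^ Fintype.card J ≤
      #P * Fintype.card A ^ Fintype.card I := by
  classical
  have hJ : Fintype.card {i // ¬ i ∈ Set.range e} + Fintype.card J = Fintype.card I := by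
    have h1 := Fintype.card_subtype_compl (fun i => i ∈ Set.range e)
    have h2 : Fintype.card {i // i ∈ Set.range e} = Fintype.card J :=
      Set.card_range_of_injective he
    have h3 := Fintype.card_le_of_injective e he
    rw [h1, h2]; omega
  have hcard : #{f : I → A | f ∘ e ∈ P} ≤
      #(P ×ˢ (univ : Finset ({i // ¬ i ∈ Set.range e} → A))) := by
    refine card_le_card_of_injOn (fun f => (f ∘ e, fun i => f i.1)) ?_ ?_
    · intro f hf
      simpa using hf
    · intro f _ g _ hfg
      simp only [Prod.mk.injEq] at hfg
      funext i
      by_cases hi : i ∈ Set.range e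
      · obtain ⟨j, rfl⟩ := hi
        exact congrFun hfg.1 j
      · exact congrFun hfg.2 ⟨i, hi⟩
  rw [card_product, card_univ, Fintype.card_fun] at hcard
  calc _ ≤ (#P * Fintype.card A ^ Fintype.card {i // ¬ i ∈ Set.range e}) *
        Fintype.card A ^ Fintype.card J := by gcongr
    _ = _ := by rw [mul_assoc, ← pow_add, hJ]

/-- A set of ordered pairs of distinct elements, no two of which share an element. -/
def IsPairMatching {I : Type*} (F : Finset (I × I)) : Prop :=
  Function.Injective fun p : F × Bool => if p.2 then p.1.1.1 else p.1.1.2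

open Finset in
/-- A random function satisfies a binary relation along a fixed matching with small
probability. -/
theorem card_forall_matching_mul_le {I A : Type*} [Fintype I] [DecidableEq I] [Fintype A]
    [DecidableEq A] (F : Finset (I × I)) (hF : IsPairMatching F) (Q : Finset (A × A)) :
    #{f : I → A | ∀ p ∈ F, (f p.1, f p.2) ∈ Q} * Fintype.card A ^ (2 * #F) ≤
      #Q ^ #F * Fintype.card (I → A) := by
  classical
  let P : Finset (F × Bool → A) := {h | ∀ p, (h (p, true), h (p, false)) ∈ Q}
  have h := card_comp_mem_mul_le _ hF P
  have hJ : Fintype.card (F × Bool) = 2 * #F := by simp [mul_comm]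
  have hP : #P ≤ #Q ^ #F := by
    have : #(Fintype.piFinset fun _ : F => Q) = #Q ^ #F := by simp
    rw [← this]
    refine card_le_card_of_injOn (fun h p => (h (p, true), h (p, false))) ?_ ?_
    · intro h hh
      simpa [P] using hh
    · intro g _ h _ hgh
      funext ⟨p, b⟩
      have := congrFun hgh p
      simp only [Prod.mk.injEq] at this
      cases b
      · exact this.2
      · exact this.1
  rw [hJ] at h
  rw [Fintype.card_fun]
  refine le_trans (le_of_eq ?_) (h.trans (Nat.mul_le_mul_right _ hP))
  congr 2
  ext f
  simp [P]

open Finset in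
/-- Union bound for the existence of a matching of given size along which a random function
satisfies a binary relation. -/
theorem card_exists_matching_mul_le {I A : Type*} [Fintype I] [DecidableEq I] [Fintype A]
    [DecidableEq A] (Q : Finset (A × A)) (k : ℕ) (X : Finset (I → A))
    (hX : ∀ f ∈ X, ∃ F : Finset (I × I), IsPairMatching F ∧ #F = k ∧
      ∀ p ∈ F, (f p.1, f p.2) ∈ Q) :
    #X * (k.factorial * Fintype.card A ^ (2 * k)) ≤
      (Fintype.card I ^ 2 * #Q) ^ k * Fintype.card (I → A) := by
  classical
  have hsub : X ⊆ ({F ∈ powersetCard k (univ : Finset (I × I)) | IsPairMatching F}).biUnion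
      fun F => {f : I → A | ∀ p ∈ F, (f p.1, f p.2) ∈ Q} := by
    intro f hf
    obtain ⟨F, h1, h2, h3⟩ := hX f hf
    simp only [mem_biUnion, mem_filter, mem_powersetCard, subset_univ, true_and, mem_univ]
    exact ⟨F, ⟨h2, h1⟩, h3⟩
  calc #X * (k.factorial * Fintype.card A ^ (2 * k))
      ≤ (∑ F ∈ powersetCard k (univ : Finset (I × I)) with IsPairMatching F,
          #{f : I → A | ∀ p ∈ F, (f p.1, f p.2) ∈ Q}) *
          (k.factorial * Fintype.card A ^ (2 * k)) := by
        gcongr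
        exact (card_le_card hsub).trans card_biUnion_le
    _ = k.factorial * ∑ F ∈ powersetCard k (univ : Finset (I × I)) with IsPairMatching F,
          #{f : I → A | ∀ p ∈ F, (f p.1, f p.2) ∈ Q} * Fintype.card A ^ (2 * k) := by
        rw [← sum_mul]; ring
    _ ≤ k.factorial * ∑ F ∈ powersetCard k (univ : Finset (I × I)) with IsPairMatching F,
          #Q ^ k * Fintype.card (I → A) := by
        refine Nat.mul_le_mul_left _ (sum_le_sum fun F hF => ?_)
        obtain ⟨h1, h2⟩ := mem_filter.1 hF
        have := card_forall_matching_mul_le F h2 Q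
        rwa [(mem_powersetCard.1 h1).2] at this
    _ ≤ k.factorial * ((Fintype.card I ^ 2).choose k * (#Q ^ k * Fintype.card (I → A))) := by
        gcongr
        rw [sum_const, smul_eq_mul]
        gcongr
        refine (card_filter_le _ _).trans ?_
        rw [card_powersetCard, card_univ, Fintype.card_prod, sq]
    _ = (Fintype.card I ^ 2).descFactorial k * #Q ^ k * Fintype.card (I → A) := by
        rw [Nat.descFactorial_eq_factorial_mul_choose]; ring
    _ ≤ (Fintype.card I ^ 2) ^ k * #Q ^ k * Fintype.card (I → A) := by
        gcongr; exact Nat.descFactorial_le_pow _ _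
    _ = _ := by rw [mul_pow]

theorem IsPairMatching.subset {I : Type*} {F G : Finset (I × I)} (hG : IsPairMatching G)
    (h : F ⊆ G) : IsPairMatching F := by
  intro p q hpq
  have := @hG (⟨p.1.1, h p.1.2⟩, p.2) (⟨q.1.1, h q.1.2⟩, q.2) hpq
  simp only [Prod.mk.injEq, Subtype.mk.injEq] at this
  exact Prod.ext (Subtype.ext this.1) this.2

theorem IsPairMatching.insert {I : Type*} [DecidableEq I] {F : Finset (I × I)}
    (hF : IsPairMatching F) {i j : I} (hij : i ≠ j)
    (h : ∀ p ∈ F, p.1 ≠ i ∧ p.1 ≠ j ∧ p.2 ≠ i ∧ p.2 ≠ j) :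
    IsPairMatching (insert (i, j) F) := by
  rintro ⟨⟨p, hp⟩, b⟩ ⟨⟨q, hq⟩, c⟩ hpq
  rcases Finset.mem_insert.1 hp with rfl | hp' <;> rcases Finset.mem_insert.1 hq with rfl | hq'
  · cases b <;> cases c <;> simp_all [eq_comm]
  · have := h q hq'
    cases b <;> cases c <;> simp_all [eq_comm]
  · have := h p hp'
    cases b <;> cases c <;> simp_all [eq_comm]
  · have := @hF (⟨p, hp'⟩, b) (⟨q, hq'⟩, c) hpq
    simpa using this

open Finset in
/-- In a loopless directed graph with in-degrees at most `L`, few disjoint edges means few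
vertices with an outgoing edge. -/
theorem exists_matching_of_indegree_le {I : Type*} [Fintype I] [DecidableEq I]
    (E : I → I → Prop) (hE : ∀ i j, E i j → i ≠ j) (L k : ℕ) (B : Finset I)
    (hB : ∀ i ∈ B, ∃ j, E i j)
    (hL : ∀ (j : I) (C : Finset I), (∀ i ∈ C, E i j) → #C ≤ L) (hk : 2 * k * (1 + L) ≤ #B) :
    ∃ F : Finset (I × I), IsPairMatching F ∧ #F = k ∧ ∀ p ∈ F, E p.1 p.2 := by
  classical
  obtain ⟨F, hF, hmax⟩ := exists_max_image
    ({F : Finset (I × I) | IsPairMatching F ∧ ∀ p ∈ F, E p.1 p.2}) card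
    ⟨∅, by simp [IsPairMatching, Function.Injective]⟩
  simp only [mem_filter, mem_univ, true_and] at hF hmax
  suffices hkF : k ≤ #F by
    obtain ⟨G, hG, hGk⟩ := exists_subset_card_eq hkF
    exact ⟨G, hF.1.subset hG, hGk, fun p hp => hF.2 p (hG hp)⟩
  by_contra! hlt
  set V := F.image Prod.fst ∪ F.image Prod.snd with hV
  have hVc : #V ≤ 2 * #F := by
    refine (card_union_le _ _).trans ?_
    have h1 : #(F.image Prod.fst) ≤ #F := card_image_le
    have h2 : #(F.image Prod.snd) ≤ #F := card_image_le
    omega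
  have hsub : B ⊆ V ∪ V.biUnion fun j => {i | E i j} := by
    intro i hi
    obtain ⟨j, hj⟩ := hB i hi
    by_contra hcon
    simp only [mem_union, mem_biUnion, mem_filter, mem_univ, true_and, not_or, not_exists,
      not_and] at hcon
    have hjV : j ∉ V := fun h => hcon.2 j h hj
    have hiV := hcon.1
    have hdis : ∀ p ∈ F, p.1 ≠ i ∧ p.1 ≠ j ∧ p.2 ≠ i ∧ p.2 ≠ j := by
      intro p hp
      have h1 : p.1 ∈ V := mem_union_left _ (mem_image_of_mem _ hp)
      have h2 : p.2 ∈ V := mem_union_right _ (mem_image_of_mem _ hp)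
      refine ⟨?_, ?_, ?_, ?_⟩ <;> rintro rfl <;> contradiction
    have hnot : (i, j) ∉ F := fun h => (hdis _ h).1 rfl
    have := hmax (insert (i, j) F) ⟨hF.1.insert (hE i j hj) hdis, by
      intro p hp
      rcases mem_insert.1 hp with rfl | hp
      · exact hj
      · exact hF.2 p hp⟩
    rw [card_insert_of_notMem hnot] at this
    omega
  have hBc : #B ≤ #V + #V * L := by
    refine (card_le_card hsub).trans ((card_union_le _ _).trans ?_)
    gcongr
    exact card_biUnion_le_card_mul _ _ _ fun j _ => hL j _ (by simp)
  have h1 : #B ≤ 2 * #F * (1 + L) := by nlinarith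
  have h2 : 2 * #F * (1 + L) < 2 * k * (1 + L) := by gcongr
  omega

/-- A word `x` is compatible with the received word `y` if `y` arises from `x` by an admissible
jamming. -/
def Compat (pe pw : ℝ) {n : ℕ} (x : Fin n → Bool) (y : Fin n → Option Bool) : Prop :=
  (numErase y : ℝ) ≤ pe * n ∧ ((Finset.univ.filter fun t => y t = some (!x t)).card : ℝ) ≤ pw * n

theorem numErase_cefOut {n : ℕ} (x : Fin n → Bool) (s : Fin n → Option Bool) :
    numErase (cefOut x s) = numErase s := by
  simp [numErase, cefOut]

theorem compat_cefOut {pe pw : ℝ} {n : ℕ} {x : Fin n → Bool} {s : Fin n → Option Bool}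
    (h : (numErase s : ℝ) ≤ pe * n ∧ (numFlip s : ℝ) ≤ pw * n) : Compat pe pw x (cefOut x s) := by
  refine ⟨by rw [numErase_cefOut]; exact h.1, ?_⟩
  have heq : ∀ t, cefOut x s t = some (!x t) ↔ s t = some true := by
    intro t
    rcases hs : s t with _ | _ | _ <;> cases hx : x t <;> simp [cefOut, hs, hx]
  simpa only [heq, numFlip] using h.2

theorem compat_cefOut_comm {pe pw : ℝ} {n : ℕ} {x x' : Fin n → Bool} {s : Fin n → Option Bool} :
    Compat pe pw x (cefOut x' s) ↔ Compat pe pw x' (cefOut x s) := by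
  simp only [Compat, numErase_cefOut]
  have heq : ∀ t, cefOut x' s t = some (!x t) ↔ cefOut x s t = some (!x' t) := by
    intro t
    rcases hs : s t with _ | _ | _ <;> cases hx : x t <;> cases hx' : x' t <;>
      simp [cefOut, hs, hx, hx']
  simp only [heq]

open Finset in
open Classical in
/-- Volume of the set of words compatible with a received word. -/
theorem card_compat_le {pe pw : ℝ} (hpe : pe < 1) (hpw : 0 ≤ pw)
    (hhalf : pw / (1 - pe) ≤ 1 / 2) {n : ℕ} (y : Fin n → Option Bool) :
    (#{x : Fin n → Bool | Compat pe pw x y} : ℝ) ≤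
      2 ^ ((n : ℝ) * (pe + (1 - pe) * binH (pw / (1 - pe)))) := by
  set q := pw / (1 - pe) with hq
  have h1pe : 0 < 1 - pe := by linarith
  have hq0 : 0 ≤ q := div_nonneg hpw h1pe.le
  have hpwq : pw = q * (1 - pe) := by rw [hq]; field_simp
  have h1q : 0 < 1 - q := by linarith
  set w := q / (1 - q) with hw
  have hw0 : 0 ≤ w := div_nonneg hq0 h1q.le
  have hw1 : w ≤ 1 := by rw [hw, div_le_one h1q]; linarith
  have h1w : 1 + w = (1 - q)⁻¹ := by rw [hw]; field_simp; ring
  by_cases hy : (numErase y : ℝ) ≤ pe * n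
  swap
  · have : (#{x : Fin n → Bool | Compat pe pw x y} : ℝ) = 0 := by
      rw [Nat.cast_eq_zero, card_eq_zero, filter_eq_empty_iff]
      exact fun x _ h => hy h.1
    rw [this]; positivity
  have hsum : ∑ x : Fin n → Bool, ∏ t, (if y t = some (!x t) then w else 1) =
      2 ^ numErase y * (1 + w) ^ (n - numErase y) := by
    have := (prod_univ_sum (fun _ : Fin n => (univ : Finset Bool))
      (fun t b => if y t = some (!b) then w else (1 : ℝ)))
    rw [Fintype.piFinset_univ] at this
    rw [← this]
    have hterm : ∀ t, ∑ b : Bool, (if y t = some (!b) then w else (1 : ℝ)) =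
        if y t = none then 2 else 1 + w := by
      intro t
      rcases y t with _ | b
      · simp [one_add_one_eq_two]
      · cases b <;> simp [add_comm]
    simp only [hterm, prod_ite, prod_const]
    congr 2
    rw [numErase, ← compl_filter, card_compl, Fintype.card_fin]
  have hprod : ∀ x : Fin n → Bool, Compat pe pw x y →
      w ^ (pw * n) ≤ ∏ t, (if y t = some (!x t) then w else 1) := by
    intro x hx
    rw [prod_ite, prod_const, prod_const_one, mul_one, ← Real.rpow_natCast]
    rcases hw0.eq_or_lt with h0 | h0
    · have hq00 : q = 0 := by
        rcases div_eq_zero_iff.1 h0.symm with h | h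
        · exact h
        · linarith
      have h2 := hx.2
      rw [hpwq, hq00, zero_mul, zero_mul] at h2
      rw [(Nat.le_zero.1 (by exact_mod_cast h2) : #{t | y t = some (!x t)} = 0), hpwq, hq00]; simp
    · exact Real.rpow_le_rpow_of_exponent_ge h0 hw1 hx.2
  have hmain : (#{x : Fin n → Bool | Compat pe pw x y} : ℝ) * w ^ (pw * n) ≤
      2 ^ numErase y * (1 + w) ^ (n - numErase y) := by
    rw [← hsum, ← nsmul_eq_mul, ← sum_const]
    refine (sum_le_sum fun x hx => hprod x (mem_filter.1 hx).2).trans ?_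
    refine sum_le_sum_of_subset_of_nonneg (filter_subset _ _) fun x _ _ => prod_nonneg fun t _ => ?_
    split_ifs <;> linarith
  have hen : numErase y ≤ n := by
    rw [numErase]; exact (card_le_univ _).trans (by simp)
  have hbd : (2 : ℝ) ^ numErase y * (1 + w) ^ (n - numErase y) ≤
      2 ^ (pe * n) * (1 + w) ^ ((1 - pe) * n) := by
    rw [← Real.rpow_natCast, ← Real.rpow_natCast, Nat.cast_sub hen]
    have e1 : (2 : ℝ) ^ (pe * n) = 2 ^ (numErase y : ℝ) * 2 ^ (pe * n - numErase y) := by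
      rw [← Real.rpow_add two_pos]; congr 1; ring
    have e2 : (1 + w) ^ ((n : ℝ) - numErase y) =
        (1 + w) ^ ((1 - pe) * n) * (1 + w) ^ (pe * n - numErase y) := by
      rw [← Real.rpow_add (by linarith)]; congr 1; ring
    rw [e1, e2]
    have : (1 + w) ^ (pe * n - numErase y) ≤ 2 ^ (pe * n - numErase y) :=
      Real.rpow_le_rpow (by linarith) (by linarith) (by linarith)
    calc _ = (2 : ℝ) ^ (numErase y : ℝ) * (1 + w) ^ ((1 - pe) * n) *
          (1 + w) ^ (pe * n - numErase y) := by ring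
      _ ≤ (2 : ℝ) ^ (numErase y : ℝ) * (1 + w) ^ ((1 - pe) * n) *
          2 ^ (pe * n - numErase y) := by
          have : 0 ≤ 1 + w := by linarith
          gcongr
      _ = _ := by ring
  have hfin : (2 : ℝ) ^ (pe * n) * (1 + w) ^ ((1 - pe) * n) =
      2 ^ ((n : ℝ) * (pe + (1 - pe) * binH q)) * w ^ (pw * n) := by
    rcases hq0.eq_or_lt with h0 | h0
    · rw [hpwq, hw, ← h0]
      simp [binH, mul_comm]
    · have hwpos : 0 < w := div_pos h0 h1q
      have l1 : (1 + w) = 2 ^ (-Real.logb 2 (1 - q)) := by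
        rw [Real.rpow_neg two_pos.le, Real.rpow_logb two_pos (by norm_num) h1q, h1w]
      have l2 : w = 2 ^ (Real.logb 2 q - Real.logb 2 (1 - q)) := by
        rw [Real.rpow_sub two_pos, Real.rpow_logb two_pos (by norm_num) h1q,
          Real.rpow_logb two_pos (by norm_num) h0]
      rw [l1, ← Real.rpow_mul two_pos.le]
      rw [l2, ← Real.rpow_mul two_pos.le, ← Real.rpow_add two_pos, ← Real.rpow_add two_pos]
      congr 1
      rw [binH, hpwq]
      ring
  rcases hw0.eq_or_lt with h0 | h0
  · have hq00 : q = 0 := by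
      rcases div_eq_zero_iff.1 h0.symm with h | h
      · exact h
      · linarith
    have : w ^ (pw * n) = 1 := by rw [hpwq, hq00]; simp
    rw [this, mul_one] at hmain hfin
    linarith
  · have hpos : 0 < w ^ (pw * n) := Real.rpow_pos_of_pos h0 _
    exact le_of_mul_le_mul_right (hmain.trans (hbd.trans hfin.le)) hpos

open Finset in
/-- Mutual information is small if the conditional probabilities are dominated by a multiple of
a subprobability mass function. -/
theorem miBits_le_logb {α β : Type*} [Fintype α] [Fintype β] (P : α → β → ℝ) (r : β → ℝ) (c : ℝ)
    (hP : ∀ a b, 0 ≤ P a b) (hP1 : ∑ a, ∑ b, P a b = 1) (hr : ∀ b, 0 ≤ r b) (hr1 : ∑ b, r b ≤ 1)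
    (hc : 0 < c) (h : ∀ a b, P a b ≤ c * ((∑ b', P a b') * r b)) :
    miBits P ≤ Real.logb 2 c := by
  have hterm : ∀ a b, P a b * Real.logb 2 (P a b / ((∑ b', P a b') * (∑ a', P a' b))) ≤
      P a b * Real.logb 2 c + P a b * (r b / (∑ a', P a' b) - 1) / Real.log 2 := by
    intro a b
    rcases (hP a b).eq_or_lt with h0 | h0
    · simp [← h0]
    have hA : 0 < ∑ b', P a b' :=
      h0.trans_le (single_le_sum (f := P a) (fun b' _ => hP a b') (mem_univ b))
    have hB : 0 < ∑ a', P a' b :=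
      h0.trans_le (single_le_sum (f := fun a' => P a' b) (fun a' _ => hP a' b) (mem_univ a))
    have hrb : 0 < r b := by
      refine (hr b).lt_of_ne fun h1 => ?_
      have := h a b
      rw [← h1] at this
      simp at this
      linarith
    have hl2 : 0 < Real.log 2 := Real.log_pos one_lt_two
    rw [mul_div_assoc, ← mul_add]
    refine mul_le_mul_of_nonneg_left ?_ (hP a b)
    calc Real.logb 2 (P a b / ((∑ b', P a b') * (∑ a', P a' b)))
        ≤ Real.logb 2 (c * (r b / ∑ a', P a' b)) := by
          refine Real.logb_le_logb_of_le one_lt_two (by positivity) ?_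
          rw [div_le_iff₀ (by positivity)]
          refine (h a b).trans (le_of_eq ?_)
          field_simp
      _ = Real.logb 2 c + Real.log (r b / ∑ a', P a' b) / Real.log 2 := by
          rw [Real.logb_mul hc.ne' (by positivity), Real.logb, Real.logb]
      _ ≤ _ := by
          gcongr
          exact Real.log_le_sub_one_of_pos (by positivity)
  have hB : ∀ b, ∑ a, P a b * (r b / (∑ a', P a' b) - 1) ≤ r b - ∑ a, P a b := by
    intro b
    rw [← sum_mul]
    rcases (sum_nonneg fun a (_ : a ∈ univ) => hP a b).eq_or_lt with h0 | h0
    · rw [← h0]; simpa using hr b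
    · rw [mul_sub, mul_div_cancel₀ _ h0.ne', mul_one]
  have hsum0 : ∑ a, ∑ b, P a b * (r b / (∑ a', P a' b) - 1) ≤ 0 := by
    rw [sum_comm]
    refine (sum_le_sum fun b _ => hB b).trans ?_
    rw [sum_sub_distrib, sum_comm, hP1]
    linarith
  calc miBits P ≤ ∑ a, ∑ b, (P a b * Real.logb 2 c +
        P a b * (r b / (∑ a', P a' b) - 1) / Real.log 2) :=
        sum_le_sum fun a _ => sum_le_sum fun b _ => hterm a b
    _ = Real.logb 2 c + (∑ a, ∑ b, P a b * (r b / (∑ a', P a' b) - 1)) / Real.log 2 := by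
        simp only [sum_add_distrib, ← sum_mul, ← sum_div, hP1, one_mul]
    _ ≤ Real.logb 2 c := by
        have : 0 < Real.log 2 := Real.log_pos one_lt_two
        have := div_nonpos_of_nonpos_of_nonneg hsum0 this.le
        linarith

open Finset in
theorem exists_cover_card_mul_le {ι Ω : Type*} [Fintype ι] [Fintype Ω]
    (p : ι → Ω → Prop) (a b : ℕ)
    (h : ∀ (i : ι) (X : Finset Ω), (∀ f ∈ X, p i f) → #X * a ≤ b) :
    ∃ B : Finset Ω, (∀ i f, p i f → f ∈ B) ∧ #B * a ≤ Fintype.card ι * b := by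
  classical
  refine ⟨univ.biUnion fun i => {f | p i f}, fun i f hf => ?_, ?_⟩
  · exact mem_biUnion.2 ⟨i, mem_univ _, mem_filter.2 ⟨mem_univ _, hf⟩⟩
  calc _ ≤ (∑ i, #{f | p i f}) * a := by
        gcongr
        exact card_biUnion_le
    _ = ∑ i, #{f | p i f} * a := sum_mul _ _ _
    _ ≤ ∑ _i : ι, b := sum_le_sum fun i _ => h i _ fun f hf => (mem_filter.1 hf).2
    _ = _ := by simp

open Finset in
theorem card_view_eq_le {n : ℕ} (T : Finset (Fin n)) (z : Fin n → Option Bool) :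
    #{x : Fin n → Bool | view T x = z} ≤ 2 ^ (n - #T) := by
  classical
  have : 2 ^ (n - #T) = #(univ : Finset ({t // t ∉ T} → Bool)) := by
    simp [Fintype.card_subtype_compl]
  rw [this]
  refine card_le_card_of_injOn (fun x t => x t.1) (fun _ _ => mem_univ _) ?_
  intro x hx x' hx' h
  have hv : view T x = view T x' := (mem_filter.1 hx).2.trans (mem_filter.1 hx').2.symm
  funext t
  by_cases ht : t ∈ T
  · simpa [view, ht] using congrFun hv t
  · exact congrFun h ⟨t, ht⟩

theorem two_pow_le_two_mul_factorial (n : ℕ) : 2 ^ n ≤ 2 * n.factorial := by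
  induction n with
  | zero => simp
  | succ n ih =>
    rcases n.eq_zero_or_pos with rfl | hn
    · simp
    · rw [pow_succ, Nat.factorial_succ]
      nlinarith [n.factorial_pos]

theorem pow_self_le_three_pow_mul_factorial (k : ℕ) : k ^ k ≤ 3 ^ k * k.factorial := by
  have h := Real.pow_div_factorial_le_exp (k : ℝ) (Nat.cast_nonneg k) k
  have h3 : Real.exp k ≤ 3 ^ k := by
    rw [← mul_one (k : ℝ), Real.exp_nat_mul]
    gcongr
    exact Real.exp_one_lt_three.le
  rw [div_le_iff₀ (by positivity)] at h
  have : (k : ℝ) ^ k ≤ 3 ^ k * k.factorial := h.trans (by gcongr)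
  exact_mod_cast this

open Finset in
open Classical in
/-- Existence of a codebook with small lists, whose codewords consistent with any given view and
message are few, and for which few codewords with any given view are confusable under any given
jamming. -/
theorem exists_good_codebook (pe pw : ℝ) {n m K k V : ℕ} (hn : 0 < n) (hm : m ≤ n)
    (hK : K ≤ 2 ^ n)
    (hV : ∀ y : Fin n → Option Bool, #{x : Fin n → Bool | Compat pe pw x y} ≤ V)
    (hrate : K * 2 ^ m * V ≤ 2 ^ n) (hk : 8 * n ≤ k) (hkK : 6 * (K ^ 2 * 2 ^ m * V) ≤ k * 2 ^ n) :
    ∃ c : Fin K × Fin (2 ^ m) → Fin n → Bool,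
      (∀ y, #{i | Compat pe pw (c i) y} ≤ 8 * n) ∧
      (∀ T : Finset (Fin n), #T = m → ∀ z u, #{i | i.1 = u ∧ view T (c i) = z} ≤ 8 * n) ∧
      ∀ T : Finset (Fin n), #T = m → ∀ z s,
        #{i | view T (c i) = z ∧ ∃ j, j ≠ i ∧ Compat pe pw (c j) (cefOut (c i) s)} ≤
          2 * k * (1 + 8 * n) := by
  set N := Fintype.card (Fin K × Fin (2 ^ m) → Fin n → Bool) with hN
  have hNpos : 0 < N := Fintype.card_pos
  have hA : Fintype.card (Fin n → Bool) = 2 ^ n := by simp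
  have hY : Fintype.card (Fin n → Option Bool) = 3 ^ n := by simp
  obtain ⟨B1, hB1, b1⟩ : ∃ B : Finset (Fin K × Fin (2 ^ m) → Fin n → Bool),
      (∀ (y : Fin n → Option Bool) (c : Fin K × Fin (2 ^ m) → Fin n → Bool),
        8 * n ≤ #{i | Compat pe pw (c i) y} → c ∈ B) ∧
      #B * (8 * n).factorial ≤ 3 ^ n * N := by
    rw [← hY]
    refine exists_cover_card_mul_le _ _ _ fun y X hX => ?_
    refine card_many_hits_mul_factorial_le (univ : Finset (Fin K × Fin (2 ^ m)))
      {x : Fin n → Bool | Compat pe pw x y} (8 * n) (by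
        rw [hA, card_univ, Fintype.card_prod, Fintype.card_fin, Fintype.card_fin]
        exact (Nat.mul_le_mul_left _ (hV y)).trans hrate) X fun c hc => ?_
    simpa using hX c hc
  have hc2 : Fintype.card (Finset (Fin n) × (Fin n → Option Bool) × Fin K) ≤ 12 ^ n := by
    rw [Fintype.card_prod, Fintype.card_prod, hY, Fintype.card_finset, Fintype.card_fin,
      Fintype.card_fin]
    calc 2 ^ n * (3 ^ n * K) ≤ 2 ^ n * (3 ^ n * 2 ^ n) := by gcongr
      _ = 12 ^ n := by rw [← mul_pow, ← mul_pow]; norm_num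
  obtain ⟨B2, hB2, b2⟩ : ∃ B : Finset (Fin K × Fin (2 ^ m) → Fin n → Bool),
      (∀ (p : Finset (Fin n) × (Fin n → Option Bool) × Fin K)
        (c : Fin K × Fin (2 ^ m) → Fin n → Bool),
        (#p.1 = m ∧ 8 * n ≤ #{i | i.1 = p.2.2 ∧ view p.1 (c i) = p.2.1}) → c ∈ B) ∧
      #B * (8 * n).factorial ≤
        Fintype.card (Finset (Fin n) × (Fin n → Option Bool) × Fin K) * N := by
    refine exists_cover_card_mul_le _ _ _ fun p X hX => ?_
    obtain ⟨T, z, u⟩ := p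
    rcases X.eq_empty_or_nonempty with rfl | ⟨c₀, hc₀⟩
    · simp
    have hT : #T = m := (hX c₀ hc₀).1
    refine card_many_hits_mul_factorial_le
      ({i | i.1 = u} : Finset (Fin K × Fin (2 ^ m)))
      {x : Fin n → Bool | view T x = z} (8 * n) (by
        have h1 : #({i | i.1 = u} : Finset (Fin K × Fin (2 ^ m))) = 2 ^ m := by
          have : ({i | i.1 = u} : Finset (Fin K × Fin (2 ^ m))) = {u} ×ˢ univ := by
            ext ⟨a, b⟩; simp [eq_comm]
          rw [this]; simp
        rw [hA, h1]
        calc _ ≤ 2 ^ m * 2 ^ (n - m) := by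
              gcongr
              rw [← hT]; exact card_view_eq_le T z
          _ = 2 ^ n := by rw [← pow_add, Nat.add_sub_cancel' hm]) X fun c hc => ?_
    simpa [filter_filter] using (hX c hc).2
  obtain ⟨B3, hB3, b3⟩ : ∃ B : Finset (Fin K × Fin (2 ^ m) → Fin n → Bool),
      (∀ (p : Finset (Fin n) × (Fin n → Option Bool) × (Fin n → Option Bool))
        (c : Fin K × Fin (2 ^ m) → Fin n → Bool), (#p.1 = m ∧
        (∀ y, #{i | Compat pe pw (c i) y} ≤ 8 * n) ∧
        2 * k * (1 + 8 * n) ≤ #{i | view p.1 (c i) = p.2.1 ∧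
          ∃ j, j ≠ i ∧ Compat pe pw (c j) (cefOut (c i) p.2.2)}) → c ∈ B) ∧
      #B * 2 ^ k ≤ 18 ^ n * N := by
    have hc : Fintype.card (Finset (Fin n) × (Fin n → Option Bool) × (Fin n → Option Bool)) =
        18 ^ n := by
      rw [Fintype.card_prod, Fintype.card_prod, hY, Fintype.card_finset, Fintype.card_fin,
        ← mul_pow, ← mul_pow]
      norm_num
    rw [← hc]
    refine exists_cover_card_mul_le _ _ _ fun p X hX => ?_
    obtain ⟨T, z, s⟩ := p
    rcases X.eq_empty_or_nonempty with rfl | ⟨c₀, hc₀⟩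
    · simp
    have hT : #T = m := (hX c₀ hc₀).1
    set Q : Finset ((Fin n → Bool) × (Fin n → Bool)) :=
      {p | view T p.1 = z ∧ Compat pe pw p.2 (cefOut p.1 s)} with hQ
    have hQc : #Q ≤ 2 ^ (n - m) * V := by
      have hsub : Q ⊆ ({x : Fin n → Bool | view T x = z} : Finset _).biUnion fun a =>
          ({x : Fin n → Bool | Compat pe pw x (cefOut a s)} : Finset _).image fun b => (a, b) := by
        rintro ⟨a, b⟩ hab
        simpa [hQ] using hab
      refine (card_le_card hsub).trans
        ((card_biUnion_le_card_mul _ _ V fun a _ => card_image_le.trans (hV _)).trans ?_)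
      gcongr
      rw [← hT]
      exact card_view_eq_le T z
    have hmain := card_exists_matching_mul_le Q k X (by
      intro c hcX
      obtain ⟨-, h1, h2⟩ := hX c hcX
      obtain ⟨F, hF, hFk, hFE⟩ := exists_matching_of_indegree_le
        (fun i j => view T (c i) = z ∧ j ≠ i ∧ Compat pe pw (c j) (cefOut (c i) s))
        (fun i j h => h.2.1.symm) (8 * n) k
        {i | view T (c i) = z ∧ ∃ j, j ≠ i ∧ Compat pe pw (c j) (cefOut (c i) s)}
        (fun i hi => by simpa using hi)
        (fun j C hC => by
          refine (card_le_card ?_).trans (h1 (cefOut (c j) s))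
          intro i hi
          exact mem_filter.2 ⟨mem_univ _, compat_cefOut_comm.1 (hC i hi).2.2⟩) h2
      exact ⟨F, hF, hFk, fun p hp => by simpa [hQ] using ⟨(hFE p hp).1, (hFE p hp).2.2⟩⟩)
    rw [hA, ← hN, Fintype.card_prod, Fintype.card_fin, Fintype.card_fin] at hmain
    have hbase : 6 * ((K * 2 ^ m) ^ 2 * #Q) ≤ k * 2 ^ (2 * n) := by
      calc 6 * ((K * 2 ^ m) ^ 2 * #Q) ≤ 6 * ((K * 2 ^ m) ^ 2 * (2 ^ (n - m) * V)) := by gcongr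
        _ = (6 * (K ^ 2 * 2 ^ m * V)) * (2 ^ m * 2 ^ (n - m)) := by ring
        _ ≤ (k * 2 ^ n) * (2 ^ m * 2 ^ (n - m)) := by gcongr
        _ = k * 2 ^ (2 * n) := by rw [← pow_add, Nat.add_sub_cancel' hm]; ring
    have hpos : 0 < k.factorial * (2 ^ n) ^ (2 * k) * 3 ^ k := by positivity
    refine Nat.le_of_mul_le_mul_left ?_ hpos
    calc k.factorial * (2 ^ n) ^ (2 * k) * 3 ^ k * (#X * 2 ^ k)
        = 6 ^ k * (#X * (k.factorial * (2 ^ n) ^ (2 * k))) := by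
          rw [show 6 = 2 * 3 from rfl, mul_pow]; ring
      _ ≤ 6 ^ k * (((K * 2 ^ m) ^ 2 * #Q) ^ k * N) := by gcongr
      _ = (6 * ((K * 2 ^ m) ^ 2 * #Q)) ^ k * N := by rw [mul_pow 6]; ring
      _ ≤ (k * 2 ^ (2 * n)) ^ k * N := by gcongr
      _ = k ^ k * (2 ^ n) ^ (2 * k) * N := by rw [mul_pow]; ring
      _ ≤ (3 ^ k * k.factorial) * (2 ^ n) ^ (2 * k) * N := by
          gcongr; exact pow_self_le_three_pow_mul_factorial k
      _ = _ := by ring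
  by_contra! hcon
  have hcover : (univ : Finset (Fin K × Fin (2 ^ m) → Fin n → Bool)) ⊆ B1 ∪ B2 ∪ B3 := by
    intro c _
    rw [mem_union, mem_union]
    by_contra! hc
    have h1 : ∀ y, #{i | Compat pe pw (c i) y} ≤ 8 * n := fun y => by
      by_contra! h
      exact hc.1.1 (hB1 y c h.le)
    have h2 : ∀ T : Finset (Fin n), #T = m → ∀ z u,
        #{i | i.1 = u ∧ view T (c i) = z} ≤ 8 * n := fun T hT z u => by
      by_contra! h
      exact hc.1.2 (hB2 (T, z, u) c ⟨hT, h.le⟩)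
    obtain ⟨T, hT, z, s, h3⟩ := hcon c h1 h2
    exact hc.2 (hB3 (T, z, s) c ⟨hT, h1, h3.le⟩)
  replace b2 := b2.trans (Nat.mul_le_mul_right _ hc2)
  have hNle : N ≤ #B1 + #B2 + #B3 := by
    have := (card_le_card hcover).trans (card_union_le _ _)
    have h2 := card_union_le B1 B2
    rw [card_univ, ← hN] at this
    omega
  have hfac : 256 ^ n ≤ 2 * (8 * n).factorial := by
    have := two_pow_le_two_mul_factorial (8 * n)
    rwa [pow_mul] at this
  have hpow : 256 ^ n ≤ 2 ^ k := by
    calc 256 ^ n = 2 ^ (8 * n) := by rw [pow_mul]; norm_num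
      _ ≤ 2 ^ k := Nat.pow_le_pow_right two_pos hk
  have hlt : 2 * 3 ^ n + 2 * 12 ^ n + 18 ^ n < 256 ^ n := by
    have h3 : 3 ^ n ≤ 18 ^ n := Nat.pow_le_pow_left (by norm_num) n
    have h12 : 12 ^ n ≤ 18 ^ n := Nat.pow_le_pow_left (by norm_num) n
    have h5 : 5 * 18 ^ n ≤ 90 ^ n := by
      rw [show 90 = 5 * 18 from rfl, mul_pow]
      gcongr
      exact Nat.le_self_pow hn.ne' 5
    have : 90 ^ n < 256 ^ n := Nat.pow_lt_pow_left (by norm_num) hn.ne'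
    omega
  have : 256 ^ n * N ≤ (2 * 3 ^ n + 2 * 12 ^ n + 18 ^ n) * N := by
    calc 256 ^ n * N ≤ 256 ^ n * (#B1 + #B2 + #B3) := by gcongr
      _ = #B1 * 256 ^ n + #B2 * 256 ^ n + #B3 * 256 ^ n := by ring
      _ ≤ #B1 * (2 * (8 * n).factorial) + #B2 * (2 * (8 * n).factorial) + #B3 * 2 ^ k := by
          gcongr
      _ = 2 * (#B1 * (8 * n).factorial) + 2 * (#B2 * (8 * n).factorial) + #B3 * 2 ^ k := by ring
      _ ≤ 2 * (3 ^ n * N) + 2 * (12 ^ n * N) + 18 ^ n * N := by gcongr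
      _ = _ := by ring
  exact absurd this (not_le.2 (Nat.mul_lt_mul_of_pos_right hlt hNpos))

/-- The stochastic encoder that sends message `u` to a uniformly random codeword `c (u, w)`. -/
noncomputable def uniformEnc {n K W : ℕ} (hW : 0 < W) (c : Fin K × Fin W → Fin n → Bool) :
    StochEnc n K where
  E u x := (1 / (W : ℝ)) * ∑ w, if c (u, w) = x then 1 else 0
  nonneg u x := mul_nonneg (by positivity) (Finset.sum_nonneg fun w _ => by split_ifs <;> simp)
  sum_one u := by
    have : (W : ℝ) ≠ 0 := by positivity
    rw [← Finset.mul_sum, Finset.sum_comm]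
    simp [this]

theorem sum_uniformEnc_mul {n K W : ℕ} (hW : 0 < W) (c : Fin K × Fin W → Fin n → Bool)
    (u : Fin K) (g : (Fin n → Bool) → ℝ) :
    ∑ x, (uniformEnc hW c).E u x * g x = (1 / (W : ℝ)) * ∑ w, g (c (u, w)) := by
  simp only [uniformEnc, mul_assoc, Finset.sum_mul, ← Finset.mul_sum]
  rw [Finset.sum_comm]
  simp

open Finset in
/-- Number of views on `T'` that extend a given view on `T`. -/
theorem card_image_view_le {n : ℕ} {T T' : Finset (Fin n)} (h : T ⊆ T') (z : Fin n → Option Bool) :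
    #(({x : Fin n → Bool | view T x = z} : Finset _).image (view T')) ≤ 2 ^ (#T' - #T) := by
  classical
  have : 2 ^ (#T' - #T) = #(univ : Finset ({t // t ∈ T' \ T} → Bool)) := by
    rw [card_univ, Fintype.card_fun, Fintype.card_bool, Fintype.card_coe, card_sdiff_of_subset h]
  rw [this]
  refine card_le_card_of_injOn (fun z' t => (z' t.1).getD false) (fun _ _ => mem_univ _) ?_
  intro a ha b hb hab
  simp only [coe_image, Set.mem_image, coe_filter, mem_univ, true_and, Set.mem_ofPred_eq] at ha hb
  obtain ⟨x, hx, rfl⟩ := ha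
  obtain ⟨x', hx', rfl⟩ := hb
  have hv : view T x = view T x' := hx.trans hx'.symm
  funext t
  by_cases ht' : t ∈ T'
  · by_cases ht : t ∈ T
    · simpa [view, ht, ht'] using congrFun hv t
    · simpa [view, ht, ht'] using congrFun hab ⟨t, mem_sdiff.2 ⟨ht', ht⟩⟩
  · simp [view, ht']

open Finset in
theorem card_range_view_le {n : ℕ} (T : Finset (Fin n)) :
    #(univ.image (view T)) ≤ 2 ^ #T := by
  have h := card_image_view_le (empty_subset T) (fun _ => none)
  rw [filter_true_of_mem fun x _ => by funext t; simp [view], card_empty, Nat.sub_zero] at h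
  exact h

open Finset in
/-- Leakage bound for a codebook in which few codewords of each message share a view. -/
theorem miBits_uniformEnc_le {n K m L : ℕ} (hK : 0 < K) (hL : 0 < L)
    (c : Fin K × Fin (2 ^ m) → Fin n → Bool) {T T' : Finset (Fin n)} (hT : T ⊆ T')
    (hT' : #T' = m) (hc : ∀ z u, #{i | i.1 = u ∧ view T' (c i) = z} ≤ L) :
    miBits (jointUZW (uniformEnc (by positivity) c) T) ≤ Real.logb 2 L := by
  classical
  have hK' : (K : ℝ) ≠ 0 := by positivity
  have hP : ∀ u z, jointUZW (uniformEnc (by positivity) c) T u z =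
      (1 / (K : ℝ)) * ((1 / (2 ^ m : ℝ)) * #{w | view T (c (u, w)) = z}) := by
    intro u z
    rw [jointUZW, sum_uniformEnc_mul]
    simp
  have hPu : ∀ u, ∑ z, jointUZW (uniformEnc (by positivity) c) T u z = 1 / (K : ℝ) := by
    intro u
    simp only [hP, ← mul_sum]
    rw [← Nat.cast_sum, sum_card_fiberwise_eq_card_filter]
    simp
  refine miBits_le_logb _
    (fun z => if z ∈ univ.image (view T) then 1 / (2 ^ #T : ℝ) else 0) L ?_ ?_ ?_ ?_
    (by exact_mod_cast hL) ?_
  · intro u z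
    rw [hP]; positivity
  · simp only [hPu]
    simp [hK']
  · intro z
    split_ifs <;> positivity
  · rw [sum_ite_mem, univ_inter, sum_const, nsmul_eq_mul, mul_one_div, div_le_one (by positivity)]
    exact_mod_cast card_range_view_le T
  · intro u z
    rw [hPu, hP]
    have hcount : #{w | view T (c (u, w)) = z} ≤ L * 2 ^ (m - #T) := by
      have h1 := card_le_mul_card_image (f := fun w => view T' (c (u, w)))
        ({w | view T (c (u, w)) = z} : Finset (Fin (2 ^ m))) L (fun z' _ => by
          refine le_trans ?_ (hc z' u)
          refine card_le_card_of_injOn (fun w => (u, w)) ?_ ?_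
          · intro w hw
            simp only [coe_filter, mem_filter, mem_univ, true_and, Set.mem_ofPred_eq] at hw ⊢
            exact hw.2
          · intro w _ w' _ h
            exact (Prod.mk.inj h).2)
      refine h1.trans (Nat.mul_le_mul_left _ ?_)
      refine (card_le_card ?_).trans ((card_image_view_le hT z).trans_eq (by rw [hT']))
      intro z' hz'
      obtain ⟨w, hw, rfl⟩ := mem_image.1 hz'
      exact mem_image_of_mem _ (by simpa using hw)
    split_ifs with hz
    · have hm : (2 : ℝ) ^ m = 2 ^ (m - #T) * 2 ^ #T := by
        rw [← pow_add, Nat.sub_add_cancel (hT' ▸ card_le_card hT)]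
      have hcount' : (#{w | view T (c (u, w)) = z} : ℝ) ≤ L * 2 ^ (m - #T) := by
        exact_mod_cast hcount
      calc (1 / (K : ℝ)) * ((1 / (2 ^ m : ℝ)) * #{w | view T (c (u, w)) = z})
          ≤ (1 / (K : ℝ)) * ((1 / (2 ^ m : ℝ)) * (L * 2 ^ (m - #T))) := by gcongr
        _ = _ := by rw [hm]; field_simp
    · have : #{w | view T (c (u, w)) = z} = 0 := by
        rw [card_eq_zero, filter_eq_empty_iff]
        rintro w - rfl
        exact hz (mem_image_of_mem _ (mem_univ _))
      simp [this]

open Finset in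
open Classical in
/-- Reliability of a codebook in which few codewords with any given view are confusable. -/
theorem exists_decoder_avgErrW_le (pe pw : ℝ) {n K m D : ℕ} (hK : 0 < K)
    (c : Fin K × Fin (2 ^ m) → Fin n → Bool)
    (hc : ∀ T : Finset (Fin n), #T = m → ∀ z s,
      #{i | view T (c i) = z ∧ ∃ j, j ≠ i ∧ Compat pe pw (c j) (cefOut (c i) s)} ≤ D) :
    ∃ Dec : (Fin n → Option Bool) → Fin K, ∀ T T' : Finset (Fin n), T ⊆ T' → #T' = m →
      ∀ JF : JamFn pe pw n,
        avgErrW (uniformEnc (by positivity) c) Dec T JF.J ≤ (D : ℝ) / K := by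
  refine ⟨fun y => if h : ∃ i, Compat pe pw (c i) y then h.choose.1 else ⟨0, hK⟩, ?_⟩
  intro T T' hT hT' JF
  set Dec : (Fin n → Option Bool) → Fin K := fun y =>
    if h : ∃ i, Compat pe pw (c i) y then h.choose.1 else ⟨0, hK⟩ with hDec
  let ρ : (Fin n → Option Bool) → Fin n → Option Bool := fun z t => if t ∈ T then z t else none
  have hρ : ∀ x, view T x = ρ (view T' x) := by
    intro x
    funext t
    by_cases ht : t ∈ T
    · simp [view, ρ, ht, hT ht]
    · simp [view, ρ, ht]
  have herr : ∀ i s, JF.J (view T (c i)) s * (if Dec (cefOut (c i) s) = i.1 then 0 else 1) ≤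
      JF.J (ρ (view T' (c i))) s *
        (if ∃ j, j ≠ i ∧ Compat pe pw (c j) (cefOut (c i) s) then 1 else 0) := by
    intro i s
    rw [← hρ]
    by_cases hJ : JF.J (view T (c i)) s = 0
    · simp [hJ]
    refine mul_le_mul_of_nonneg_left ?_ (JF.nonneg _ _)
    have hi : Compat pe pw (c i) (cefOut (c i) s) := compat_cefOut (JF.supp _ _ hJ)
    by_cases hbad : ∃ j, j ≠ i ∧ Compat pe pw (c j) (cefOut (c i) s)
    · rw [if_pos hbad]
      split_ifs <;> simp
    · have hex : ∃ j, Compat pe pw (c j) (cefOut (c i) s) := ⟨i, hi⟩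
      have hch : hex.choose = i := by
        by_contra hne
        exact hbad ⟨_, hne, hex.choose_spec⟩
      have : Dec (cefOut (c i) s) = i.1 := by
        rw [hDec]
        simp only [dif_pos hex, hch]
      simp [this, hbad]
  have hsum : ∑ i, ∑ s, JF.J (ρ (view T' (c i))) s *
      (if ∃ j, j ≠ i ∧ Compat pe pw (c j) (cefOut (c i) s) then 1 else 0) ≤ (2 ^ m * D : ℝ) := by
    calc _ = ∑ z ∈ univ.image (view T'), ∑ i with view T' (c i) = z, ∑ s, JF.J (ρ z) s *
          (if ∃ j, j ≠ i ∧ Compat pe pw (c j) (cefOut (c i) s) then (1 : ℝ) else 0) := by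
          rw [← sum_fiberwise_of_maps_to (t := univ.image (view T'))
            (g := fun i => view T' (c i)) fun i _ => mem_image_of_mem _ (mem_univ _)]
          refine sum_congr rfl fun z _ => sum_congr rfl fun i hi => ?_
          rw [(mem_filter.1 hi).2]
      _ = ∑ z ∈ univ.image (view T'), ∑ s, JF.J (ρ z) s *
          (#{i | view T' (c i) = z ∧ ∃ j, j ≠ i ∧ Compat pe pw (c j) (cefOut (c i) s)} : ℝ) := by
          refine sum_congr rfl fun z _ => ?_
          rw [sum_comm]
          refine sum_congr rfl fun s _ => ?_
          rw [← mul_sum, sum_boole, filter_filter]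
      _ ≤ ∑ z ∈ univ.image (view T'), ∑ s, JF.J (ρ z) s * (D : ℝ) := by
          refine sum_le_sum fun z _ => sum_le_sum fun s _ =>
            mul_le_mul_of_nonneg_left ?_ (JF.nonneg _ _)
          exact_mod_cast hc T' hT' z s
      _ = #(univ.image (view T')) * (D : ℝ) := by
          simp only [← sum_mul, JF.sum_one, one_mul, sum_const, nsmul_eq_mul]
      _ ≤ 2 ^ m * D := by
          gcongr
          rw [← hT']
          exact_mod_cast card_range_view_le T'
  have hform : avgErrW (uniformEnc (by positivity) c) Dec T JF.J =
      (1 / (K : ℝ)) * ((1 / (2 ^ m : ℝ)) * ∑ i, ∑ s, JF.J (view T (c i)) s *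
        (if Dec (cefOut (c i) s) = i.1 then 0 else 1)) := by
    simp only [avgErrW, sum_uniformEnc_mul, ← mul_sum, Fintype.sum_prod_type]
    simp
  rw [hform]
  calc _ ≤ (1 / (K : ℝ)) * ((1 / (2 ^ m : ℝ)) * (2 ^ m * D)) := by
        gcongr
        exact (sum_le_sum fun i _ => sum_le_sum fun s _ => herr i s).trans hsum
    _ = (D : ℝ) / K := by field_simp

theorem securelyAchievableW_of_nonpos {pr pe pw R : ℝ} (hR : R ≤ 0) :
    SecurelyAchievableW pr pe pw R := by
  intro ε hε
  refine ⟨1, 1, uniformEnc one_pos fun _ _ => false, fun _ => 0, one_pos, one_pos, ?_, ?_⟩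
  · simpa using Real.rpow_le_one_of_one_le_of_nonpos one_le_two hR
  refine fun T _ => ⟨fun JF => ?_, ?_⟩
  · have : avgErrW (uniformEnc one_pos fun _ : Fin 1 × Fin 1 => fun _ : Fin 1 => false)
        (fun _ => 0) T JF.J = 0 := by
      simp [avgErrW, Fin.fin_one_eq_zero]
    rw [this]; exact hε.le
  · have hP : ∀ u z, jointUZW (uniformEnc one_pos fun _ : Fin 1 × Fin 1 => fun _ : Fin 1 => false)
        T u z = if view T (fun _ => false) = z then 1 else 0 := by
      intro u z
      rw [jointUZW, sum_uniformEnc_mul]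
      simp
    have h := miBits_le_logb
      (jointUZW (uniformEnc one_pos fun _ : Fin 1 × Fin 1 => fun _ : Fin 1 => false) T)
      (fun z => if view T (fun _ => false) = z then 1 else 0) 1
      (fun u z => by rw [hP]; split_ifs <;> norm_num) (by simp [hP])
      (fun z => by split_ifs <;> norm_num) (by simp) one_pos (fun u z => by simp [hP])
    rw [Real.logb_one] at h
    simpa using h.trans hε.le

theorem binH_nonneg {q : ℝ} (h0 : 0 ≤ q) (h1 : q ≤ 1) : 0 ≤ binH q := by
  have a := mul_nonneg h0 (neg_nonneg.2 (Real.logb_nonpos one_lt_two h0 h1))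
  have b := mul_nonneg (sub_nonneg.2 h1)
    (neg_nonneg.2 (Real.logb_nonpos one_lt_two (sub_nonneg.2 h1) (by linarith)))
  rw [binH]
  linarith

open Filter Topology in
theorem eventually_blocklength {γ R ε : ℝ} (hγ : 0 < γ) (hR : 0 < R) (hε : 0 < ε) :
    ∀ᶠ n : ℕ in atTop, 0 < n ∧ 1 ≤ γ * n ∧
      24 * (1 + 8 * n) * (2 : ℝ) ^ (-γ * n) + 2 * (1 + 8 * n) ^ 2 * (2 : ℝ) ^ (-R * n) ≤ ε ∧
      Real.logb 2 (8 * n) ≤ ε * n := by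
  have hpow : ∀ a : ℝ, 0 < a → ∀ k : ℕ, Tendsto (fun n : ℕ => (n : ℝ) ^ k * (2 : ℝ) ^ (-a * n))
      atTop (𝓝 0) := by
    intro a ha k
    have h := tendsto_pow_const_mul_const_pow_of_abs_lt_one k (r := (2 : ℝ) ^ (-a)) (by
      rw [abs_of_pos (by positivity)]
      exact Real.rpow_lt_one_of_one_lt_of_neg one_lt_two (by linarith))
    simpa only [Real.rpow_mul_natCast two_pos.le] using h
  have h1 := ((hpow γ hγ 1).const_mul 216).add ((hpow R hR 2).const_mul 162)
  simp only [mul_zero, add_zero] at h1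
  have h2 : Tendsto (fun n : ℕ => γ * (n : ℝ)) atTop atTop :=
    tendsto_natCast_atTop_atTop.const_mul_atTop hγ
  have h3 : Tendsto (fun n : ℕ => Real.log (8 * (n : ℝ)) / (8 * (n : ℝ))) atTop (𝓝 0) :=
    Real.isLittleO_log_id_atTop.tendsto_div_nhds_zero.comp
      (tendsto_natCast_atTop_atTop.const_mul_atTop (by norm_num))
  have hl2 : 0 < Real.log 2 := Real.log_pos one_lt_two
  filter_upwards [eventually_gt_atTop 0, h2.eventually_ge_atTop 1, h1.eventually_le_const hε,
    h3.eventually_le_const (show 0 < ε * Real.log 2 / 8 by positivity)] with n hn e2 e1 e3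
  refine ⟨hn, e2, ?_, ?_⟩
  · have hn1 : (1 : ℝ) ≤ n := by exact_mod_cast hn
    have h9 : 1 + 8 * (n : ℝ) ≤ 9 * n := by linarith
    calc 24 * (1 + 8 * n) * (2 : ℝ) ^ (-γ * n) + 2 * (1 + 8 * n) ^ 2 * (2 : ℝ) ^ (-R * n)
        ≤ 24 * (9 * n) * (2 : ℝ) ^ (-γ * n) + 2 * (9 * n) ^ 2 * (2 : ℝ) ^ (-R * n) := by gcongr
      _ ≤ ε := by refine le_trans (le_of_eq ?_) e1; ring
  · have hn0 : (0 : ℝ) < n := by exact_mod_cast hn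
    rw [div_le_iff₀ (by positivity)] at e3
    rw [Real.logb, div_le_iff₀ hl2]
    linarith

/-- **Achievable secrecy rates for the wiretap channel of type II with erasing and
flipping adversary `WCEF-II(p_r, p_e, p_w)`:** every secrecy rate below
`1 - p_r + p_e·H(p_w/(1-p_e)) - p_e - H(p_w/(1-p_e))` is securely achievable. -/
theorem wcef2_secrecy_achievability (pr pe pw : ℝ) (hpr : 0 ≤ pr) (hpe : 0 ≤ pe)
    (hpw : 0 ≤ pw) (hsum : pe + pw ≤ 1) (hhalf : pw / (1 - pe) ≤ 1 / 2)
    (R : ℝ)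
    (hR : R < 1 - pr + pe * binH (pw / (1 - pe)) - pe - binH (pw / (1 - pe))) :
    SecurelyAchievableW pr pe pw R := by
  classical
  rcases le_or_gt R 0 with hR0 | hR0
  · exact securelyAchievableW_of_nonpos hR0
  have hpe1 : pe < 1 := by
    by_contra! h
    have h1 : pe = 1 := by linarith
    subst h1
    simp [binH] at hR
    linarith
  set q := pw / (1 - pe) with hq
  have hq0 : 0 ≤ q := div_nonneg hpw (by linarith)
  have hH : 0 ≤ (1 - pe) * binH q :=
    mul_nonneg (by linarith) (binH_nonneg hq0 (by linarith))
  set γ := 1 - pe - (1 - pe) * binH q - pr - R with hγ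
  have hγ0 : 0 < γ := by rw [hγ]; linarith
  intro ε hε
  obtain ⟨n, hn, hn1, hn2, hn3⟩ := (eventually_blocklength hγ0 hR0 hε).exists
  have hn0 : (0 : ℝ) < n := by exact_mod_cast hn
  set m := ⌊pr * n⌋₊ with hm
  have hmr : (m : ℝ) ≤ pr * n := Nat.floor_le (by positivity)
  have hmn : m ≤ n := by
    have : pr * n ≤ 1 * n := by gcongr; linarith
    exact_mod_cast (hmr.trans this).trans_eq (one_mul _)
  set K := ⌈(2 : ℝ) ^ (R * n)⌉₊ with hK
  have hKl : (2 : ℝ) ^ (R * n) ≤ K := Nat.le_ceil _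
  have h1R : (1 : ℝ) ≤ 2 ^ (R * n) := Real.one_le_rpow one_le_two (by positivity)
  have hK0 : 0 < K := by exact_mod_cast (one_pos.trans_le (h1R.trans hKl))
  have hKu : (K : ℝ) ≤ 2 * 2 ^ (R * n) := by
    have := (Nat.ceil_lt_add_one (show (0 : ℝ) ≤ 2 ^ (R * n) by positivity)).le
    linarith
  have hKn : K ≤ 2 ^ n := by
    have : (K : ℝ) ≤ 2 ^ n := by
      calc (K : ℝ) ≤ 2 ^ (1 : ℝ) * 2 ^ (R * n) := by simpa using hKu
        _ = 2 ^ (1 + R * n) := by rw [← Real.rpow_add two_pos]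
        _ ≤ 2 ^ (n : ℝ) := by
            refine Real.rpow_le_rpow_of_exponent_le one_le_two ?_
            have : (γ + R) * n ≤ 1 * n := by
              gcongr
              rw [hγ]; linarith
            linarith
        _ = 2 ^ n := Real.rpow_natCast _ _
    exact_mod_cast this
  set V := ⌊(2 : ℝ) ^ ((n : ℝ) * (pe + (1 - pe) * binH q))⌋₊ with hVdef
  have hVu : (V : ℝ) ≤ 2 ^ ((n : ℝ) * (pe + (1 - pe) * binH q)) := Nat.floor_le (by positivity)
  have hV : ∀ y : Fin n → Option Bool,
      (Finset.univ.filter fun x : Fin n → Bool => Compat pe pw x y).card ≤ V := fun y =>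
    Nat.le_floor (by convert card_compat_le hpe1 hpw hhalf y)
  have hload : (K : ℝ) * 2 ^ m * V ≤ 2 * 2 ^ (-γ * n) * 2 ^ n := by
    calc (K : ℝ) * 2 ^ m * V ≤ (2 * 2 ^ (R * n)) * 2 ^ (pr * n) *
          2 ^ ((n : ℝ) * (pe + (1 - pe) * binH q)) := by
          gcongr
          rw [← Real.rpow_natCast]
          exact Real.rpow_le_rpow_of_exponent_le one_le_two hmr
      _ = 2 * 2 ^ (R * n + pr * n + (n : ℝ) * (pe + (1 - pe) * binH q)) := by
          rw [Real.rpow_add two_pos, Real.rpow_add two_pos]; ring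
      _ = 2 * 2 ^ (-γ * n + n) := by
          congr 2; rw [hγ]; ring
      _ = _ := by rw [Real.rpow_add two_pos, Real.rpow_natCast]; ring
  have hrate : K * 2 ^ m * V ≤ 2 ^ n := by
    have h2 : 2 * (2 : ℝ) ^ (-γ * n) ≤ 1 := by
      have : (2 : ℝ) ^ (-γ * n) ≤ 2 ^ (-1 : ℝ) :=
        Real.rpow_le_rpow_of_exponent_le one_le_two (by linarith)
      rw [Real.rpow_neg_one] at this
      linarith
    have : (K : ℝ) * 2 ^ m * V ≤ 2 ^ n :=
      hload.trans (mul_le_of_le_one_left (by positivity) h2)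
    exact_mod_cast this
  set k := ⌈12 * (K : ℝ) * 2 ^ (-γ * n)⌉₊ + 8 * n with hk
  have hku : (k : ℝ) ≤ 12 * (K : ℝ) * 2 ^ (-γ * n) + (1 + 8 * n) := by
    have := (Nat.ceil_lt_add_one (show (0 : ℝ) ≤ 12 * (K : ℝ) * 2 ^ (-γ * n) by positivity)).le
    rw [hk]
    push_cast
    linarith
  have hkl : 12 * (K : ℝ) * 2 ^ (-γ * n) ≤ k := by
    rw [hk]
    push_cast
    have := Nat.le_ceil (12 * (K : ℝ) * 2 ^ (-γ * n))
    linarith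
  have hk8 : 8 * n ≤ k := Nat.le_add_left _ _
  clear_value k
  have hkK : 6 * (K ^ 2 * 2 ^ m * V) ≤ k * 2 ^ n := by
    have : (6 : ℝ) * (K ^ 2 * 2 ^ m * V) ≤ k * 2 ^ n := by
      calc (6 : ℝ) * (K ^ 2 * 2 ^ m * V) = 6 * K * (K * 2 ^ m * V) := by ring
        _ ≤ 6 * K * (2 * 2 ^ (-γ * n) * 2 ^ n) := by gcongr
        _ = 12 * (K : ℝ) * 2 ^ (-γ * n) * 2 ^ n := by ring
        _ ≤ k * 2 ^ n := by gcongr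
    exact_mod_cast this
  obtain ⟨c, -, hc2, hc3⟩ := exists_good_codebook pe pw hn hmn hKn
    (fun y => by convert hV y) hrate hk8 hkK
  obtain ⟨Dec, hDec⟩ := exists_decoder_avgErrW_le pe pw hK0 c hc3
  refine ⟨n, K, uniformEnc (by positivity) c, Dec, hn, hK0, hKl, fun T hT => ?_⟩
  obtain ⟨T', hTT', hT'⟩ : ∃ T', T ⊆ T' ∧ T'.card = m := by
    obtain ⟨T', h1, -, h2⟩ := Finset.exists_subsuperset_card_eq (Finset.subset_univ T)
      (Nat.le_floor hT) (by simpa using hmn)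
    exact ⟨T', h1, h2⟩
  refine ⟨fun JF => (hDec T T' hTT' hT' JF).trans ?_, ?_⟩
  · rw [div_le_iff₀ (by exact_mod_cast hK0)]
    have hKinv : 1 ≤ (K : ℝ) * 2 ^ (-R * n) := by
      calc (1 : ℝ) = 2 ^ (R * n) * 2 ^ (-R * n) := by
            rw [← Real.rpow_add two_pos]; simp
        _ ≤ K * 2 ^ (-R * n) := by gcongr
    push_cast
    calc 2 * (k : ℝ) * (1 + 8 * n)
        ≤ 2 * (12 * (K : ℝ) * 2 ^ (-γ * n) + (1 + 8 * n)) * (1 + 8 * n) := by gcongr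
      _ = 24 * (1 + 8 * n) * 2 ^ (-γ * n) * K + 2 * (1 + 8 * n) ^ 2 * 1 := by ring
      _ ≤ 24 * (1 + 8 * n) * 2 ^ (-γ * n) * K +
          2 * (1 + 8 * n) ^ 2 * (K * 2 ^ (-R * n)) := by gcongr
      _ = (24 * (1 + 8 * n) * (2 : ℝ) ^ (-γ * n) +
          2 * (1 + 8 * n) ^ 2 * (2 : ℝ) ^ (-R * n)) * K := by ring
      _ ≤ ε * K := by gcongr
  · have h := miBits_uniformEnc_le hK0 (by positivity : 0 < 8 * n) c hTT' hT'
      (fun z u => by convert hc2 T' hT' z u)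
    rw [one_div_mul_eq_div, div_le_iff₀ hn0]
    refine h.trans (le_trans (le_of_eq ?_) hn3)
    push_cast
    rfl
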